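/- Consider the linear regression model with n observations y₁,…,y_n ∈ ℝ, covariate vectors x₁,…,x_n ∈ ℝ^p such that any p distinct vectors among them are linearly independent, error density f(z) = (1-s)·φ(z;0,1) + s·∫₀^∞ φ(z;0,u)·H(u;γ) du with γ > 0 and s ∈ (0,1), likelihood ∏_{i=1}^n (1/σ)·f((y_i − x_iᵀβ)/σ), and prior density π(β,σ) = π_σ(σ)·∏_{k=1}^p (1/σ)·π_β(β_k/σ) on ℝ^p × (0,∞), where π_β is a probability density on ℝ and π_σ is a probability density on (0,∞). Partition {1,…,n} into disjoint sets K (non-outliers) and L (outliers), and let y_i = a_i for i ∈ K and y_i = a_i + b_i·ω with b_i ≠ 0 for i ∈ L, where ω > 0. Let p(β,σ|D) denote the posterior density based on all n observations and p(β,σ|D*) the posterior density based only on the observations {y_i : i ∈ K}. Assume: (A.1) |K| ≥ |L| + p; (A.2) there exists c > 0 with sup_{t∈ℝ} |t|^c·π_β(t) < ∞; (A.3) ∫₀^∞ σ^{−|K|}·π_σ(σ) dσ < ∞, ∫₀^∞ σ^{c−1}·π_σ(σ) dσ < ∞, and ∫₀^∞ σ^{c−n}·π_σ(σ) dσ < ∞.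 Then for all (β,σ) ∈ ℝ^p × (0,∞), lim_{ω→∞} p(β,σ|D) = p(β,σ|D*). -/

import Mathlib

open MeasureTheory Real Filter Set
open scoped RealInnerProductSpace BigOperators

/-- Normal density with mean `0` and variance `u`. -/
noncomputable def normPdf (z u : ℝ) : ℝ :=
  (Real.sqrt (2 * Real.pi * u))⁻¹ * Real.exp (-(z ^ 2) / (2 * u))

/-- Density of the `H`-distribution with parameter `γ`. -/
noncomputable def Hdens (γ u : ℝ) : ℝ :=
  γ / ((1 + u) * (1 + Real.log (1 + u)) ^ (1 + γ))

/-- The extremely heavily-tailed error density. -/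
noncomputable def fEH (γ s z : ℝ) : ℝ :=
  (1 - s) * normPdf z 1 + s * ∫ u in Set.Ioi (0:ℝ), normPdf z u * Hdens γ u

/-- Unnormalized posterior density (prior times likelihood over a subset `S` of
the observation indices) for the linear regression model with EH errors. -/
noncomputable def postNum (n p : ℕ) (γ s : ℝ) (pβ pσ : ℝ → ℝ)
    (x : Fin n → EuclideanSpace ℝ (Fin p)) (S : Finset (Fin n)) (y : Fin n → ℝ)
    (β : EuclideanSpace ℝ (Fin p)) (σ : ℝ) : ℝ :=
  pσ σ * (∏ k : Fin p, σ⁻¹ * pβ (β k / σ)) *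
    ∏ i ∈ S, σ⁻¹ * fEH γ s ((y i - ⟪x i, β⟫) / σ)

/-- The logarithmic factor `1 + log (1 + z²)`. -/
noncomputable def logFactor (z : ℝ) : ℝ := 1 + Real.log (1 + z ^ 2)

/-- The reciprocal `|z| (1 + log (1 + z²)) ^ (1 + γ)` of the tail order of `fEH`. -/
noncomputable def tailRate (γ z : ℝ) : ℝ := |z| * logFactor z ^ (1 + γ)

lemma one_le_one_add_log {y : ℝ} (hy : 0 ≤ y) : 1 ≤ 1 + Real.log (1 + y) := by
  have := Real.log_nonneg (show (1:ℝ) ≤ 1 + y by linarith)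
  linarith

lemma one_add_log_le {y : ℝ} (hy : 0 ≤ y) : 1 + Real.log (1 + y) ≤ 1 + y := by
  have := Real.log_le_sub_one_of_pos (show (0:ℝ) < 1 + y by linarith)
  linarith

lemma one_le_logFactor (z : ℝ) : 1 ≤ logFactor z := one_le_one_add_log (sq_nonneg z)

lemma logFactor_pos (z : ℝ) : 0 < logFactor z := one_pos.trans_le (one_le_logFactor z)

lemma logFactor_mono {z w : ℝ} (h : |z| ≤ |w|) : logFactor z ≤ logFactor w := by
  have := sq_le_sq.mpr h
  have := Real.log_le_log (by positivity) (show 1 + z ^ 2 ≤ 1 + w ^ 2 by linarith)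
  unfold logFactor
  linarith

lemma one_add_log_le_mul {y v : ℝ} (hy : 0 ≤ y) (hv : 0 < v) :
    1 + Real.log (1 + y) ≤ (1 + Real.log (1 + y * v)) * (1 + Real.log (1 + v⁻¹)) := by
  have hle : 1 + y ≤ (1 + y * v) * (1 + v⁻¹) := by
    have : (1 + y * v) * (1 + v⁻¹) = 1 + y + (y * v + v⁻¹) := by field_simp; ring
    have : 0 ≤ y * v + v⁻¹ := by positivity
    linarith
  have h1 := Real.log_le_log (by positivity) hle
  rw [Real.log_mul (by positivity) (by positivity)] at h1
  have h2 := one_le_one_add_log (show 0 ≤ y * v by positivity)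
  have h3 := one_le_one_add_log (show 0 ≤ v⁻¹ by positivity)
  nlinarith

lemma logFactor_le_mul {z t : ℝ} (ht : t ≠ 0) :
    logFactor z ≤ logFactor (z * t) * logFactor t⁻¹ := by
  have := one_add_log_le_mul (sq_nonneg z) (show 0 < t ^ 2 by positivity)
  simpa only [logFactor, mul_pow, inv_pow] using this

lemma tailRate_nonneg (γ z : ℝ) : 0 ≤ tailRate γ z :=
  mul_nonneg (abs_nonneg z) (Real.rpow_nonneg (logFactor_pos z).le _)

lemma tailRate_pos (γ : ℝ) {z : ℝ} (hz : z ≠ 0) : 0 < tailRate γ z :=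
  mul_pos (abs_pos.mpr hz) (Real.rpow_pos_of_pos (logFactor_pos z) _)

lemma tailRate_mono {γ z w : ℝ} (hγ : 0 < γ) (h : |z| ≤ |w|) : tailRate γ z ≤ tailRate γ w :=
  mul_le_mul h (Real.rpow_le_rpow (logFactor_pos z).le (logFactor_mono h) (by linarith))
    (Real.rpow_nonneg (logFactor_pos z).le _) (abs_nonneg w)

lemma logFactor_rpow_le (m : ℝ) (hm : 0 < m) :
    ∃ C : ℝ, ∀ w : ℝ, 0 ≤ w → logFactor w ^ m ≤ C * (1 + w) := by
  refine ⟨(1 + 2 * m) ^ m, fun w hw => ?_⟩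
  have hε : (0:ℝ) < 1 / (2 * m) := by positivity
  have h1 := Real.log_le_rpow_div (show (0:ℝ) ≤ 1 + w ^ 2 by positivity) hε
  have h2 : (1:ℝ) ≤ (1 + w ^ 2) ^ (1 / (2 * m)) :=
    Real.one_le_rpow (by nlinarith) hε.le
  have h3 : logFactor w ≤ (1 + 2 * m) * (1 + w ^ 2) ^ (1 / (2 * m)) := by
    have : (1 + w ^ 2) ^ (1 / (2 * m)) / (1 / (2 * m)) =
      2 * m * (1 + w ^ 2) ^ (1 / (2 * m)) := by field_simp
    rw [this] at h1
    unfold logFactor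
    linarith
  refine (Real.rpow_le_rpow (logFactor_pos w).le h3 hm.le).trans ?_
  rw [Real.mul_rpow (by positivity) (by positivity), ← Real.rpow_mul (by positivity)]
  have h4 : 1 / (2 * m) * m = 1 / 2 := by field_simp
  rw [h4, ← Real.sqrt_eq_rpow]
  gcongr
  rw [Real.sqrt_le_left (by linarith)]
  nlinarith

lemma rpow_mul_exp_neg_half_le (m : ℝ) :
    ∃ C : ℝ, ∀ w : ℝ, 0 ≤ w → (1 + w) ^ m * Real.exp (-(w / 2)) ≤ C := by
  obtain ⟨k, hk⟩ := exists_nat_ge m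
  refine ⟨2 ^ k * (k.factorial : ℝ) * Real.exp (1 / 2), fun w hw => ?_⟩
  have h1 := Real.pow_div_factorial_le_exp ((1 + w) / 2) (by positivity) k
  have h2 : (1 + w) ^ m ≤ (1 + w) ^ k := by
    rw [← Real.rpow_natCast]
    exact Real.rpow_le_rpow_of_exponent_le (by linarith) hk
  rw [div_le_iff₀ (by positivity), div_pow, div_le_iff₀ (by positivity)] at h1
  calc (1 + w) ^ m * Real.exp (-(w / 2))
      ≤ (Real.exp ((1 + w) / 2) * k.factorial * 2 ^ k) * Real.exp (-(w / 2)) := by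
        gcongr
        exact h2.trans h1
    _ = 2 ^ k * (k.factorial : ℝ) * (Real.exp ((1 + w) / 2) * Real.exp (-(w / 2))) := by ring
    _ = _ := by
        rw [← Real.exp_add]
        congr 2
        ring

lemma normPdf_nonneg (z u : ℝ) : 0 ≤ normPdf z u := by
  unfold normPdf
  positivity

lemma inv_sqrt_two_pi_mul_le {u : ℝ} (hu : 0 < u) :
    (Real.sqrt (2 * Real.pi * u))⁻¹ ≤ u ^ (-(1 / 2) : ℝ) := by
  rw [Real.rpow_neg hu.le, ← Real.sqrt_eq_rpow]
  gcongr
  nlinarith [Real.pi_gt_three]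

lemma normPdf_le {z u : ℝ} (hu : 0 < u) : normPdf z u ≤ u ^ (-(1 / 2) : ℝ) := by
  have h : Real.exp (-(z ^ 2) / (2 * u)) ≤ 1 := by
    rw [Real.exp_le_one_iff]
    exact div_nonpos_of_nonpos_of_nonneg (by nlinarith) (by positivity)
  exact (mul_le_of_le_one_right (by positivity) h).trans (inv_sqrt_two_pi_mul_le hu)

lemma Hdens_nonneg {γ u : ℝ} (hγ : 0 < γ) (hu : 0 < u) : 0 ≤ Hdens γ u := by
  have := one_le_one_add_log hu.le
  unfold Hdens
  positivity

lemma Hdens_le {γ u : ℝ} (hγ : 0 < γ) (hu : 0 < u) : Hdens γ u ≤ γ * (1 + u)⁻¹ := by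
  have := Real.one_le_rpow (one_le_one_add_log hu.le) (show 0 ≤ 1 + γ by linarith)
  rw [Hdens, div_eq_mul_inv]
  gcongr
  nlinarith

lemma measurable_normPdf_mul_Hdens (γ : ℝ) :
    Measurable fun q : ℝ × ℝ => normPdf q.1 q.2 * Hdens γ q.2 := by
  unfold normPdf Hdens
  fun_prop

lemma integrableOn_rpow_mul_inv :
    IntegrableOn (fun u : ℝ => u ^ (-(1 / 2) : ℝ) * (1 + u)⁻¹) (Set.Ioi 0) := by
  rw [← Set.Ioc_union_Ioi_eq_Ioi zero_le_one]
  have hm : Measurable fun u : ℝ => u ^ (-(1 / 2) : ℝ) * (1 + u)⁻¹ := by fun_prop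
  refine IntegrableOn.union ?_ ?_
  · have h := (intervalIntegral.intervalIntegrable_rpow' (a := 0) (b := 1)
      (show (-1:ℝ) < -(1 / 2) by norm_num)).1
    refine Integrable.mono' h hm.aestronglyMeasurable ?_
    refine (ae_restrict_iff' measurableSet_Ioc).mpr (Eventually.of_forall fun u hu => ?_)
    have hu0 : 0 < u := hu.1
    rw [Real.norm_of_nonneg (by positivity)]
    refine mul_le_of_le_one_right (by positivity) (inv_le_one_of_one_le₀ (by linarith))
  · refine Integrable.mono' (integrableOn_Ioi_rpow_of_lt (a := -(3 / 2)) (by norm_num) one_pos)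
      hm.aestronglyMeasurable ?_
    refine (ae_restrict_iff' measurableSet_Ioi).mpr (Eventually.of_forall fun u hu => ?_)
    have hu0 : 0 < u := one_pos.trans hu
    rw [Real.norm_of_nonneg (by positivity)]
    have : u ^ (-(3 / 2) : ℝ) = u ^ (-(1 / 2) : ℝ) * u⁻¹ := by
      rw [← Real.rpow_neg_one, ← Real.rpow_add hu0]
      norm_num
    rw [this]
    gcongr
    linarith

lemma fEH_pos {γ s : ℝ} (hγ : 0 < γ) (hs : s ∈ Set.Ioo (0:ℝ) 1) (z : ℝ) : 0 < fEH γ s z := by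
  have h1 : 0 < normPdf z 1 := by
    unfold normPdf
    positivity
  have h2 : 0 ≤ ∫ u in Set.Ioi (0:ℝ), normPdf z u * Hdens γ u :=
    setIntegral_nonneg measurableSet_Ioi fun u hu =>
      mul_nonneg (normPdf_nonneg z u) (Hdens_nonneg hγ hu)
  have := mul_pos (sub_pos.mpr hs.2) h1
  have := mul_nonneg hs.1.le h2
  unfold fEH
  linarith

lemma fEH_bounded {γ s : ℝ} (hγ : 0 < γ) (hs : s ∈ Set.Ioo (0:ℝ) 1) :
    ∃ M : ℝ, ∀ z, fEH γ s z ≤ M := by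
  refine ⟨(1 - s) * 1 + s * ∫ u in Set.Ioi (0:ℝ), γ * (u ^ (-(1 / 2) : ℝ) * (1 + u)⁻¹),
    fun z => ?_⟩
  have h0 := hs.1
  have h1 := hs.2
  unfold fEH
  refine add_le_add (mul_le_mul_of_nonneg_left ?_ (by linarith))
    (mul_le_mul_of_nonneg_left ?_ h0.le)
  · simpa using normPdf_le (z := z) one_pos
  · refine integral_mono_of_nonneg ?_ (integrableOn_rpow_mul_inv.const_mul γ) ?_
    · exact (ae_restrict_iff' measurableSet_Ioi).mpr (Eventually.of_forall fun u hu =>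
        mul_nonneg (normPdf_nonneg z u) (Hdens_nonneg hγ hu))
    · refine (ae_restrict_iff' measurableSet_Ioi).mpr (Eventually.of_forall fun u hu => ?_)
      have hu0 : 0 < u := hu
      refine (mul_le_mul (normPdf_le hu) (Hdens_le hγ hu) (Hdens_nonneg hγ hu)
        (by positivity)).trans (le_of_eq (by ring))

lemma measurable_fEH (γ s : ℝ) : Measurable (fEH γ s) := by
  have h := (measurable_normPdf_mul_Hdens γ).stronglyMeasurable.integral_prod_right'
    (ν := volume.restrict (Set.Ioi (0:ℝ)))
  have h1 : Measurable fun z => normPdf z 1 := by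
    unfold normPdf
    fun_prop
  exact (h1.const_mul _).add (h.measurable.const_mul s)

/-- The integrand of the mixture in `fEH` after the substitution `u = z² v`, multiplied by
`tailRate γ z`. -/
noncomputable def scaledIntegrand (γ z v : ℝ) : ℝ :=
  (Real.sqrt (2 * Real.pi * v))⁻¹ * Real.exp (-(v⁻¹ / 2)) * γ * (z ^ 2 / (1 + z ^ 2 * v)) *
    (logFactor z / (1 + Real.log (1 + z ^ 2 * v))) ^ (1 + γ)

lemma mixture_mul_tailRate (γ : ℝ) {z : ℝ} (hz : z ≠ 0) :
    (∫ u in Set.Ioi (0:ℝ), normPdf z u * Hdens γ u) * tailRate γ z =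
      ∫ v in Set.Ioi (0:ℝ), scaledIntegrand γ z v := by
  have hz2 : 0 < z ^ 2 := by positivity
  have h := integral_comp_mul_left_Ioi (fun u => normPdf z u * Hdens γ u) 0 hz2
  rw [mul_zero, smul_eq_mul, eq_inv_mul_iff_mul_eq₀ hz2.ne'] at h
  rw [← h, ← integral_const_mul, ← integral_mul_const]
  refine setIntegral_congr_fun measurableSet_Ioi fun v hv => ?_
  have hv0 : 0 < v := hv
  have h1 := one_le_one_add_log (show 0 ≤ z ^ 2 * v by positivity)
  have h2 : Real.sqrt (2 * Real.pi * (z ^ 2 * v)) = |z| * Real.sqrt (2 * Real.pi * v) := by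
    rw [show 2 * Real.pi * (z ^ 2 * v) = z ^ 2 * (2 * Real.pi * v) by ring,
      Real.sqrt_mul hz2.le, Real.sqrt_sq_eq_abs]
  have h3 : -(z ^ 2) / (2 * (z ^ 2 * v)) = -(v⁻¹ / 2) := by field_simp
  have h4 : 0 < |z| := abs_pos.mpr hz
  simp only [normPdf, Hdens, tailRate, scaledIntegrand, h2, h3]
  rw [Real.div_rpow (logFactor_pos z).le (by linarith)]
  field_simp

lemma scaledIntegrand_nonneg {γ : ℝ} (hγ : 0 < γ) (z : ℝ) {v : ℝ} (hv : 0 < v) :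
    0 ≤ scaledIntegrand γ z v := by
  have h1 := one_le_one_add_log (show 0 ≤ z ^ 2 * v by positivity)
  have := logFactor_pos z
  unfold scaledIntegrand
  positivity

lemma scaledIntegrand_le {γ : ℝ} (hγ : 0 < γ) :
    ∃ C : ℝ, ∀ z v : ℝ, 0 < v → scaledIntegrand γ z v ≤ C * (v + 1) ^ (-(3 / 2) : ℝ) := by
  obtain ⟨C, hC⟩ := rpow_mul_exp_neg_half_le (1 + γ + 3 / 2)
  refine ⟨C * γ, fun z v hv => ?_⟩
  have h1 := one_le_one_add_log (show 0 ≤ z ^ 2 * v by positivity)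
  have hlog : logFactor z / (1 + Real.log (1 + z ^ 2 * v)) ≤ 1 + v⁻¹ := by
    rw [div_le_iff₀ (by linarith), mul_comm]
    refine (one_add_log_le_mul (sq_nonneg z) hv).trans ?_
    exact mul_le_mul_of_nonneg_left (one_add_log_le (by positivity)) (by linarith)
  have hquot : z ^ 2 / (1 + z ^ 2 * v) ≤ v⁻¹ := by
    rw [div_le_iff₀ (by positivity), mul_add, mul_one]
    have : v⁻¹ * (z ^ 2 * v) = z ^ 2 := by field_simp
    have : 0 < v⁻¹ := by positivity
    linarith
  have hpos : 0 ≤ logFactor z / (1 + Real.log (1 + z ^ 2 * v)) :=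
    div_nonneg (logFactor_pos z).le (by linarith)
  have hv1 : v ^ (-(1 / 2) : ℝ) * v⁻¹ = (v + 1) ^ (-(3 / 2) : ℝ) * (1 + v⁻¹) ^ (3 / 2 : ℝ) := by
    have : v = (v + 1) / (1 + v⁻¹) := by field_simp
    have h3 : v ^ (-(1 / 2) : ℝ) * v⁻¹ = v ^ (-(3 / 2) : ℝ) := by
      rw [← Real.rpow_neg_one v, ← Real.rpow_add hv]
      norm_num
    rw [h3]
    conv_lhs => rw [this]
    rw [Real.div_rpow (by positivity) (by positivity), Real.rpow_neg (x := 1 + v⁻¹) (by positivity)]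
    field_simp
  calc scaledIntegrand γ z v
      ≤ v ^ (-(1 / 2) : ℝ) * Real.exp (-(v⁻¹ / 2)) * γ * v⁻¹ * (1 + v⁻¹) ^ (1 + γ) := by
        unfold scaledIntegrand
        gcongr
        exact inv_sqrt_two_pi_mul_le hv
    _ = (v ^ (-(1 / 2) : ℝ) * v⁻¹) * Real.exp (-(v⁻¹ / 2)) * γ * (1 + v⁻¹) ^ (1 + γ) := by ring
    _ = ((1 + v⁻¹) ^ (1 + γ + 3 / 2) * Real.exp (-(v⁻¹ / 2))) * γ *
          (v + 1) ^ (-(3 / 2) : ℝ) := by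
        rw [hv1, Real.rpow_add (show 0 < 1 + v⁻¹ by positivity) (1 + γ) (3 / 2)]
        ring
    _ ≤ C * γ * (v + 1) ^ (-(3 / 2) : ℝ) := by
        gcongr
        exact hC _ (by positivity)

lemma tendsto_one_add_log_div {ι : Type*} {l : Filter ι} {A B : ι → ℝ} {r : ℝ}
    (hA : ∀ i, 0 ≤ A i) (hB : ∀ i, 0 ≤ B i) (hBtop : Tendsto B l atTop) (hr : 0 < r)
    (h : Tendsto (fun i => (1 + A i) / (1 + B i)) l (nhds r)) :
    Tendsto (fun i => (1 + Real.log (1 + A i)) / (1 + Real.log (1 + B i))) l (nhds 1) := by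
  have hden : Tendsto (fun i => 1 + Real.log (1 + B i)) l atTop :=
    tendsto_atTop_add_const_left _ _
      (Real.tendsto_log_atTop.comp (tendsto_atTop_add_const_left _ _ hBtop))
  have hlim := (h.log hr.ne').div_atTop hden
  have hlim1 := hlim.const_add 1
  rw [add_zero] at hlim1
  refine hlim1.congr fun i => ?_
  have h1 := one_le_one_add_log (hB i)
  have h2 := hA i
  have h3 := hB i
  rw [Real.log_div (by positivity) (by positivity)]
  have : 1 + Real.log (1 + B i) ≠ 0 := by linarith
  field_simp
  ring

lemma tendsto_sq_comap_abs : Tendsto (fun z : ℝ => z ^ 2) (comap abs atTop) atTop := by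
  have : Tendsto (fun z : ℝ => |z| ^ 2) (comap abs atTop) atTop :=
    (tendsto_pow_atTop two_ne_zero).comp tendsto_comap
  simpa only [sq_abs] using this

lemma tendsto_scaledIntegrand (γ : ℝ) {v : ℝ} (hv : 0 < v) :
    Tendsto (fun z => scaledIntegrand γ z v) (comap abs atTop)
      (nhds ((Real.sqrt (2 * Real.pi * v))⁻¹ * Real.exp (-(v⁻¹ / 2)) * γ * v⁻¹)) := by
  have hinv : Tendsto (fun z : ℝ => (z ^ 2)⁻¹) (comap abs atTop) (nhds 0) :=
    tendsto_inv_atTop_zero.comp tendsto_sq_comap_abs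
  have hne : ∀ᶠ z : ℝ in comap abs atTop, 0 < z ^ 2 :=
    tendsto_sq_comap_abs.eventually_gt_atTop 0
  have h1 : Tendsto (fun z : ℝ => z ^ 2 / (1 + z ^ 2 * v)) (comap abs atTop) (nhds v⁻¹) := by
    have := (hinv.add_const v).inv₀ (by simpa using hv.ne')
    rw [zero_add] at this
    refine this.congr' (hne.mono fun z hz => ?_)
    have hz0 : z ≠ 0 := by rintro rfl; simp at hz
    field_simp
  have h2 : Tendsto (fun z : ℝ => (1 + z ^ 2) / (1 + z ^ 2 * v)) (comap abs atTop)
      (nhds v⁻¹) := by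
    have := (hinv.add_const 1).div (hinv.add_const v) (by simpa using hv.ne')
    rw [zero_add, zero_add, one_div] at this
    refine this.congr' (hne.mono fun z hz => ?_)
    have hz0 : z ≠ 0 := by rintro rfl; simp at hz
    simp only [Pi.div_apply]
    field_simp
  have h3 := tendsto_one_add_log_div (fun z : ℝ => sq_nonneg z)
    (fun z : ℝ => mul_nonneg (sq_nonneg z) hv.le)
    (tendsto_sq_comap_abs.atTop_mul_const hv) (inv_pos.mpr hv) h2
  have h4 := h3.rpow_const (p := 1 + γ) (Or.inl one_ne_zero)
  rw [Real.one_rpow] at h4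
  have h5 := (h1.const_mul
    ((Real.sqrt (2 * Real.pi * v))⁻¹ * Real.exp (-(v⁻¹ / 2)) * γ)).mul h4
  rw [mul_one] at h5
  exact h5

lemma integrableOn_one_add_rpow :
    IntegrableOn (fun v : ℝ => (v + 1) ^ (-(3 / 2) : ℝ)) (Set.Ioi 0) :=
  integrableOn_add_rpow_Ioi_of_lt (by norm_num) (by norm_num)

lemma measurable_scaledIntegrand (γ z : ℝ) : Measurable (scaledIntegrand γ z) := by
  unfold scaledIntegrand
  fun_prop

lemma tendsto_mixture {γ : ℝ} (hγ : 0 < γ) :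
    ∃ C : ℝ, 0 < C ∧
      Tendsto (fun z => (∫ u in Set.Ioi (0:ℝ), normPdf z u * Hdens γ u) * tailRate γ z)
        (comap abs atTop) (nhds C) := by
  obtain ⟨C, hC⟩ := scaledIntegrand_le hγ
  set g : ℝ → ℝ := fun v =>
    (Real.sqrt (2 * Real.pi * v))⁻¹ * Real.exp (-(v⁻¹ / 2)) * γ * v⁻¹ with hg
  have hbound : Integrable (fun v : ℝ => C * (v + 1) ^ (-(3 / 2) : ℝ))
      (volume.restrict (Set.Ioi 0)) := integrableOn_one_add_rpow.const_mul C
  have hgpos : ∀ v ∈ Set.Ioi (0:ℝ), 0 < g v := fun v hv => by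
    have hv0 : 0 < v := hv
    rw [hg]
    positivity
  have hlim : Tendsto (fun z => ∫ v in Set.Ioi (0:ℝ), scaledIntegrand γ z v) (comap abs atTop)
      (nhds (∫ v in Set.Ioi (0:ℝ), g v)) := by
    refine tendsto_integral_filter_of_dominated_convergence _
      (Eventually.of_forall fun z => (measurable_scaledIntegrand γ z).aestronglyMeasurable)
      (Eventually.of_forall fun z => ?_) hbound ?_
    · refine (ae_restrict_iff' measurableSet_Ioi).mpr (Eventually.of_forall fun v hv => ?_)
      rw [Real.norm_of_nonneg (scaledIntegrand_nonneg hγ z hv)]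
      exact hC z v hv
    · exact (ae_restrict_iff' measurableSet_Ioi).mpr
        (Eventually.of_forall fun v hv => tendsto_scaledIntegrand γ hv)
  have : (comap (abs : ℝ → ℝ) atTop).NeBot :=
    comap_neBot fun t ht => by
      obtain ⟨a, ha⟩ := mem_atTop_sets.mp ht
      exact ⟨|a|, ha _ ((le_abs_self a).trans (le_abs_self _))⟩
  have hgint : IntegrableOn g (Set.Ioi 0) := by
    have hgm : Measurable g := by
      rw [hg]
      fun_prop
    refine Integrable.mono' hbound hgm.aestronglyMeasurable ?_
    refine (ae_restrict_iff' measurableSet_Ioi).mpr (Eventually.of_forall fun v hv => ?_)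
    rw [Real.norm_of_nonneg (hgpos v hv).le]
    exact le_of_tendsto (tendsto_scaledIntegrand γ hv) (Eventually.of_forall fun z => hC z v hv)
  refine ⟨∫ v in Set.Ioi (0:ℝ), g v, ?_, hlim.congr' ?_⟩
  · rw [setIntegral_pos_iff_support_of_nonneg_ae _ hgint]
    · have : Function.support g ∩ Set.Ioi 0 = Set.Ioi 0 :=
        Set.inter_eq_right.mpr fun v hv => (hgpos v hv).ne'
      rw [this]
      simp
    · exact (ae_restrict_iff' measurableSet_Ioi).mpr
        (Eventually.of_forall fun v hv => (hgpos v hv).le)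
  · filter_upwards [tendsto_sq_comap_abs.eventually_gt_atTop 0] with z hz
    exact (mixture_mul_tailRate γ (by rintro rfl; simp at hz)).symm

lemma tendsto_normPdf_one_mul_tailRate {γ : ℝ} (hγ : 0 < γ) :
    Tendsto (fun z => normPdf z 1 * tailRate γ z) (comap abs atTop) (nhds 0) := by
  have h := tendsto_rpow_mul_exp_neg_mul_atTop_nhds_zero (2 + γ) (1 / 2) (by norm_num)
  have h2 : Tendsto (fun z : ℝ => 1 + z ^ 2) (comap abs atTop) atTop :=
    tendsto_atTop_add_const_left _ _ tendsto_sq_comap_abs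
  have h3 := (h.comp h2).const_mul (Real.exp (1 / 2))
  rw [mul_zero] at h3
  refine squeeze_zero (fun z => mul_nonneg (normPdf_nonneg z 1) (tailRate_nonneg γ z))
    (fun z => ?_) h3
  have hn : normPdf z 1 ≤ Real.exp (-(z ^ 2) / 2) := by
    unfold normPdf
    have h4 := inv_sqrt_two_pi_mul_le one_pos
    rw [Real.one_rpow] at h4
    rw [mul_one 2]
    exact mul_le_of_le_one_left (Real.exp_pos _).le h4
  have ht : tailRate γ z ≤ (1 + z ^ 2) * (1 + z ^ 2) ^ (1 + γ) := by
    unfold tailRate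
    have := logFactor_pos z
    gcongr
    · nlinarith [sq_nonneg (|z| - 1), sq_abs z]
    · exact one_add_log_le (sq_nonneg z)
  refine (mul_le_mul hn ht (tailRate_nonneg γ z) (Real.exp_pos _).le).trans (le_of_eq ?_)
  have e1 : (1 + z ^ 2) ^ (2 + γ) = (1 + z ^ 2) * (1 + z ^ 2) ^ (1 + γ) := by
    rw [show 2 + γ = 1 + (1 + γ) by ring, Real.rpow_add (by positivity), Real.rpow_one]
  have e2 : Real.exp (-(z ^ 2) / 2) = Real.exp (1 / 2) * Real.exp (-(1 / 2) * (1 + z ^ 2)) := by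
    rw [← Real.exp_add]
    congr 1
    ring
  simp only [Function.comp_apply, e1, e2]
  ring

lemma tendsto_fEH_mul_tailRate {γ s : ℝ} (hγ : 0 < γ) (hs : s ∈ Set.Ioo (0:ℝ) 1) :
    ∃ C : ℝ, 0 < C ∧
      Tendsto (fun z => fEH γ s z * tailRate γ z) (comap abs atTop) (nhds C) := by
  obtain ⟨C, hC, h⟩ := tendsto_mixture hγ
  refine ⟨s * C, mul_pos hs.1 hC, ?_⟩
  have := ((tendsto_normPdf_one_mul_tailRate hγ).const_mul (1 - s)).add (h.const_mul s)
  rw [mul_zero, zero_add] at this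
  refine this.congr fun z => ?_
  unfold fEH
  ring

lemma fEH_mul_tailRate_bounded {γ s : ℝ} (hγ : 0 < γ) (hs : s ∈ Set.Ioo (0:ℝ) 1) :
    ∃ C : ℝ, 0 < C ∧ ∀ z, fEH γ s z * tailRate γ z ≤ C := by
  obtain ⟨C, hC, h⟩ := tendsto_fEH_mul_tailRate hγ hs
  obtain ⟨M, hM⟩ := fEH_bounded hγ hs
  have hev := h.eventually_le_const (lt_add_one C)
  rw [eventually_comap, eventually_atTop] at hev
  obtain ⟨R, hR⟩ := hev
  have hMpos : 0 < M := (fEH_pos hγ hs 0).trans_le (hM 0)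
  refine ⟨max (C + 1) (M * tailRate γ R), lt_max_of_lt_left (by linarith), fun z => ?_⟩
  rcases le_total R |z| with hz | hz
  · exact (hR |z| hz z rfl).trans (le_max_left _ _)
  · refine le_max_of_le_right (mul_le_mul (hM z) (tailRate_mono hγ (hz.trans (le_abs_self R)))
      (tailRate_nonneg γ z) hMpos.le)

lemma tendsto_abs_affine {α : ℝ} (hα : α ≠ 0) (β : ℝ) :
    Tendsto (fun ω : ℝ => α * ω + β) atTop (comap abs atTop) := by
  rw [tendsto_comap_iff]
  have h : Tendsto (fun ω : ℝ => |α| * ω + -|β|) atTop atTop :=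
    tendsto_atTop_add_const_right _ _ (tendsto_id.const_mul_atTop (abs_pos.mpr hα))
  refine tendsto_atTop_mono' _ ?_ h
  filter_upwards [eventually_ge_atTop 0] with ω hω
  have h1 := abs_sub_abs_le_abs_sub (α * ω) (-β)
  rw [abs_mul, abs_of_nonneg hω, abs_neg, sub_neg_eq_add] at h1
  simpa [sub_eq_add_neg] using h1

lemma tendsto_logFactor_div {α : ℝ} (hα : α ≠ 0) (β : ℝ) :
    Tendsto (fun ω : ℝ => logFactor ω / logFactor (α * ω + β)) atTop (nhds 1) := by
  refine tendsto_one_add_log_div (r := 1 / α ^ 2) (fun ω => sq_nonneg ω)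
    (fun ω => sq_nonneg (α * ω + β)) (tendsto_sq_comap_abs.comp (tendsto_abs_affine hα β))
    (by positivity) ?_
  have h1 : Tendsto (fun ω : ℝ => ω⁻¹) atTop (nhds 0) := tendsto_inv_atTop_zero
  have h2 := ((h1.pow 2).add_const 1).div
    ((h1.pow 2).add (((h1.const_mul β).const_add α).pow 2)) (by simpa using hα)
  have e : ((0:ℝ) ^ 2 + 1) / (0 ^ 2 + (α + β * 0) ^ 2) = 1 / α ^ 2 := by simp
  rw [e] at h2
  refine h2.congr' ?_
  filter_upwards [eventually_gt_atTop 0] with ω hω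
  simp only [Pi.div_apply]
  field_simp

lemma tendsto_scaled_fEH_mul_tailRate {γ s C : ℝ}
    (h : Tendsto (fun z => fEH γ s z * tailRate γ z) (comap abs atTop) (nhds C))
    {b σ : ℝ} (hb : b ≠ 0) (hσ : 0 < σ) (t : ℝ) :
    Tendsto (fun ω => tailRate γ ω * (σ⁻¹ * fEH γ s ((t + b * ω) / σ))) atTop
      (nhds (C / |b|)) := by
  have hα : b / σ ≠ 0 := div_ne_zero hb hσ.ne'
  have haff := tendsto_abs_affine hα (t / σ)
  have h1 := h.comp haff
  have h2 := (tendsto_logFactor_div hα (t / σ)).rpow_const (p := 1 + γ) (Or.inl one_ne_zero)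
  rw [Real.one_rpow] at h2
  have h3 : Tendsto (fun ω : ℝ => |ω| / (σ * |b / σ * ω + t / σ|)) atTop (nhds (1 / |b|)) := by
    have h4 : Tendsto (fun ω : ℝ => ω⁻¹) atTop (nhds 0) := tendsto_inv_atTop_zero
    have h5 := ((h4.const_mul t).const_add b).abs.inv₀ (by simpa using hb)
    rw [mul_zero, add_zero, ← one_div] at h5
    refine h5.congr' ?_
    filter_upwards [eventually_gt_atTop 0] with ω hω
    have e1 : b / σ * ω + t / σ = (b + t * ω⁻¹) * ω / σ := by field_simp
    rw [e1, abs_div, abs_mul, abs_of_pos hσ, abs_of_pos hω]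
    field_simp
  have h6 := (h1.mul h3).mul h2
  rw [mul_one, mul_one_div] at h6
  refine h6.congr' ?_
  have hne := (tendsto_comap.comp haff).eventually_gt_atTop 0
  filter_upwards [hne] with ω hω
  simp only [Function.comp_apply] at hω ⊢
  have e2 : (t + b * ω) / σ = b / σ * ω + t / σ := by ring
  rw [e2]
  generalize b / σ * ω + t / σ = z at *
  have hl : 0 < logFactor z ^ (1 + γ) := Real.rpow_pos_of_pos (logFactor_pos z) _
  rw [Real.div_rpow (logFactor_pos ω).le (logFactor_pos z).le]
  unfold tailRate
  field_simp

lemma exists_norm_le_of_linearIndependent {n p : ℕ} (x : Fin n → EuclideanSpace ℝ (Fin p))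
    (t : Finset (Fin n)) (ht : t.card = p) (h : LinearIndependent ℝ (fun i : t => x i)) :
    ∃ κ : ℝ, 0 < κ ∧ ∀ β : EuclideanSpace ℝ (Fin p),
      β ≠ 0 → ∃ i ∈ t, κ * ‖β‖ ≤ |⟪x i, β⟫| := by
  let f : EuclideanSpace ℝ (Fin p) →ₗ[ℝ] (t → ℝ) :=
    LinearMap.pi fun i : t => (innerSL ℝ (x i)).toLinearMap
  have hf : ∀ β i, f β i = ⟪x i, β⟫ := fun β i => rfl
  have hspan : Submodule.span ℝ (Set.range fun i : t => x i) = ⊤ :=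
    h.span_eq_top_of_card_eq_finrank' (by simp [ht])
  have hker : f.ker = ⊥ := by
    rw [LinearMap.ker_eq_bot']
    intro β hβ
    have hmem : β ∈ Submodule.span ℝ (Set.range fun i : t => x i) := hspan ▸ Submodule.mem_top
    have hall : ∀ w ∈ Submodule.span ℝ (Set.range fun i : t => x i), ⟪w, β⟫ = 0 := by
      intro w hw
      induction hw using Submodule.span_induction with
      | mem w hw =>
        obtain ⟨i, rfl⟩ := hw
        rw [← hf, hβ, Pi.zero_apply]
      | zero => exact inner_zero_left β
      | add u v _ _ hu hv => rw [inner_add_left, hu, hv, add_zero]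
      | smul c u _ hu => rw [inner_smul_left, hu, mul_zero]
    exact inner_self_eq_zero.mp (hall β hmem)
  obtain ⟨A, hA, hanti⟩ := f.exists_antilipschitzWith hker
  refine ⟨(A:ℝ)⁻¹ / 2, by positivity, fun β hβ => ?_⟩
  by_contra! hlt
  have hβn : 0 < ‖β‖ := norm_pos_iff.mpr hβ
  have h1 : ‖f β‖ ≤ (A:ℝ)⁻¹ / 2 * ‖β‖ := by
    rw [pi_norm_le_iff_of_nonneg (by positivity)]
    intro i
    rw [hf]
    exact (hlt i i.2).le
  have h2 := hanti.le_mul_dist β 0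
  rw [dist_zero_right, map_zero, dist_zero_right] at h2
  have h3 : (A:ℝ) * ‖f β‖ ≤ ‖β‖ / 2 := by
    refine (mul_le_mul_of_nonneg_left h1 (by positivity)).trans (le_of_eq ?_)
    field_simp
  linarith

/-- If every `p` of the covariates are linearly independent, then all but fewer than `p` of the
linear predictors are comparable to the norm of the coefficient vector. -/
lemma exists_uniform_lower_bound {n p : ℕ} (x : Fin n → EuclideanSpace ℝ (Fin p))
    (hx : ∀ t : Finset (Fin n), t.card = p → LinearIndependent ℝ (fun i : t => x i)) :
    ∃ κ : ℝ, 0 < κ ∧ ∀ β : EuclideanSpace ℝ (Fin p), β ≠ 0 → ∀ t : Finset (Fin n),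
      p ≤ t.card → ∃ i ∈ t, κ * ‖β‖ ≤ |⟪x i, β⟫| := by
  have h : ∀ t : Finset (Fin n), ∃ κ : ℝ, 0 < κ ∧ (t.card = p →
      ∀ β : EuclideanSpace ℝ (Fin p), β ≠ 0 → ∃ i ∈ t, κ * ‖β‖ ≤ |⟪x i, β⟫|) := by
    intro t
    by_cases ht : t.card = p
    · obtain ⟨κ, h0, h1⟩ := exists_norm_le_of_linearIndependent x t ht (hx t ht)
      exact ⟨κ, h0, fun _ => h1⟩
    · exact ⟨1, one_pos, fun h => absurd h ht⟩
  choose κ hκ hb using h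
  obtain ⟨t₀, -, hmin⟩ := Finset.exists_min_image (Finset.univ : Finset (Finset (Fin n))) κ
    ⟨∅, Finset.mem_univ _⟩
  refine ⟨κ t₀, hκ t₀, fun β hβ t ht => ?_⟩
  obtain ⟨u, hut, hu⟩ := Finset.exists_subset_card_eq ht
  obtain ⟨i, hi, hle⟩ := hb u hu β hβ
  exact ⟨i, hut hi,
    (mul_le_mul_of_nonneg_right (hmin u (Finset.mem_univ u)) (norm_nonneg β)).trans hle⟩

/-- For large `ω`, whatever `β` is, at least `|L|` residuals have size of order `ω`. -/
lemma eventually_exists_large_residuals {n p : ℕ} (x : Fin n → EuclideanSpace ℝ (Fin p))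
    (hx : ∀ t : Finset (Fin n), t.card = p → LinearIndependent ℝ (fun i : t => x i))
    (K L : Finset (Fin n)) (hKL : Disjoint K L) (a b : Fin n → ℝ) (hb : ∀ i ∈ L, b i ≠ 0)
    (hA1 : L.card + p ≤ K.card) :
    ∃ δ : ℝ, 0 < δ ∧ ∀ᶠ ω : ℝ in atTop, ∀ β : EuclideanSpace ℝ (Fin p),
      ∃ S : Finset (Fin n), S.card = L.card ∧
        ∀ i ∈ S, δ * ω ≤ |(if i ∈ K then a i else a i + b i * ω) - ⟪x i, β⟫| := by
  obtain ⟨κ, hκ, hlow⟩ := exists_uniform_lower_bound x hx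
  obtain ⟨b₀, hb₀, hbL⟩ : ∃ b₀ : ℝ, 0 < b₀ ∧ ∀ i ∈ L, b₀ ≤ |b i| := by
    rcases L.eq_empty_or_nonempty with rfl | hL
    · exact ⟨1, one_pos, by simp⟩
    · obtain ⟨j, hj, hmin⟩ := L.exists_min_image (fun i => |b i|) hL
      exact ⟨|b j|, abs_pos.mpr (hb j hj), hmin⟩
  set X : ℝ := 1 + ∑ i, ‖x i‖
  have hX0 : 0 < X := by positivity
  have hxX : ∀ i, ‖x i‖ ≤ X := fun i =>
    (Finset.single_le_sum (f := fun i => ‖x i‖) (fun i _ => norm_nonneg _)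
      (Finset.mem_univ i)).trans (by linarith)
  set A : ℝ := ∑ i, |a i|
  have haA : ∀ i, |a i| ≤ A := fun i =>
    Finset.single_le_sum (f := fun i => |a i|) (fun i _ => abs_nonneg _) (Finset.mem_univ i)
  set ε : ℝ := b₀ / (2 * X) with hε
  have hε0 : 0 < ε := by positivity
  have hXε : X * ε = b₀ / 2 := by rw [hε]; field_simp
  set δ : ℝ := min (b₀ / 4) (κ * ε / 2)
  have hδ0 : 0 < δ := by positivity
  refine ⟨δ, hδ0, ?_⟩
  filter_upwards [eventually_ge_atTop (A / δ), eventually_gt_atTop 0] with ω hω hω0 β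
  rw [div_le_iff₀ hδ0, mul_comm] at hω
  have hδ1 : δ * ω ≤ b₀ / 4 * ω := mul_le_mul_of_nonneg_right (min_le_left _ _) hω0.le
  have hδ2 : δ * ω ≤ κ * ε / 2 * ω := mul_le_mul_of_nonneg_right (min_le_right _ _) hω0.le
  rcases lt_or_ge ‖β‖ (ε * ω) with hβ | hβ
  · refine ⟨L, rfl, fun i hi => ?_⟩
    rw [if_neg (Finset.disjoint_right.mp hKL hi)]
    have h1 : |⟪x i, β⟫| ≤ b₀ / 2 * ω := by
      refine (abs_real_inner_le_norm _ _).trans ((mul_le_mul (hxX i) hβ.le (norm_nonneg _)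
        hX0.le).trans (le_of_eq ?_))
      rw [← mul_assoc, hXε]
    have h2 : b₀ * ω ≤ |b i * ω| := by
      rw [abs_mul, abs_of_pos hω0]
      exact mul_le_mul_of_nonneg_right (hbL i hi) hω0.le
    have h3 := haA i
    have h4 := abs_sub_abs_le_abs_sub (b i * ω) (⟪x i, β⟫ - a i)
    have h5 := abs_sub (⟪x i, β⟫) (a i)
    have h6 : b i * ω - (⟪x i, β⟫ - a i) = a i + b i * ω - ⟪x i, β⟫ := by ring
    rw [h6] at h4
    linarith
  · have hβ0 : β ≠ 0 := by
      rintro rfl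
      rw [norm_zero] at hβ
      have : 0 < ε * ω := by positivity
      linarith
    set T := K.filter fun i => κ * ‖β‖ ≤ |⟪x i, β⟫| with hT
    have hcard : L.card ≤ T.card := by
      by_contra! hlt
      have h1 := Finset.card_filter_add_card_filter_not (s := K)
        (fun i => κ * ‖β‖ ≤ |⟪x i, β⟫|)
      obtain ⟨i, hi, hle⟩ := hlow β hβ0 (K.filter fun i => ¬ κ * ‖β‖ ≤ |⟪x i, β⟫|) (by
        rw [← hT] at h1
        omega)
      exact (Finset.mem_filter.mp hi).2 hle
    obtain ⟨S, hST, hS⟩ := Finset.exists_subset_card_eq hcard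
    refine ⟨S, hS, fun i hi => ?_⟩
    have hiT := Finset.mem_filter.mp (hST hi)
    rw [if_pos hiT.1]
    have h1 : κ * ε * ω ≤ |⟪x i, β⟫| := by
      refine le_trans ?_ hiT.2
      rw [mul_assoc]
      exact mul_le_mul_of_nonneg_left hβ hκ.le
    have h2 := haA i
    have h3 := abs_sub_abs_le_abs_sub (⟪x i, β⟫) (a i)
    rw [abs_sub_comm] at h3
    linarith

/-- The prior density of the coefficients given the scale. -/
noncomputable def scaledPrior {p : ℕ} (pβ : ℝ → ℝ) (β : EuclideanSpace ℝ (Fin p)) (σ : ℝ) : ℝ :=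
  ∏ k : Fin p, σ⁻¹ * pβ (β k / σ)

lemma integrable_scaledPrior {p : ℕ} {pβ : ℝ → ℝ} (h : Integrable pβ) {σ : ℝ} (hσ : 0 < σ) :
    Integrable fun β : EuclideanSpace ℝ (Fin p) => scaledPrior pβ β σ := by
  have h1 : Integrable fun t => σ⁻¹ * pβ (t / σ) := (h.comp_div hσ.ne').const_mul _
  have h2 : Integrable (fun v : Fin p → ℝ => ∏ k, σ⁻¹ * pβ (v k / σ)) :=
    Integrable.fintype_prod fun _ => h1
  exact (PiLp.volume_preserving_ofLp (Fin p)).integrable_comp_of_integrable h2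

lemma integral_scaledPrior {p : ℕ} {pβ : ℝ → ℝ} (h1 : ∫ t, pβ t = 1) {σ : ℝ} (hσ : 0 < σ) :
    ∫ β : EuclideanSpace ℝ (Fin p), scaledPrior pβ β σ = 1 := by
  have h2 := (PiLp.volume_preserving_ofLp (Fin p)).integral_comp
    (MeasurableEquiv.toLp 2 (Fin p → ℝ)).symm.measurableEmbedding
    (fun v : Fin p → ℝ => ∏ k, σ⁻¹ * pβ (v k / σ))
  refine h2.trans ?_
  rw [integral_fintype_prod_volume_eq_prod (fun _ : Fin p => fun t : ℝ => σ⁻¹ * pβ (t / σ))]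
  refine Finset.prod_eq_one fun k _ => ?_
  rw [integral_const_mul, Measure.integral_comp_div, h1, abs_of_pos hσ, smul_eq_mul, mul_one,
    inv_mul_cancel₀ hσ.ne']

lemma quasiMeasurePreserving_coord_div (p : ℕ) (k : Fin p) :
    Measure.QuasiMeasurePreserving
      (fun q : EuclideanSpace ℝ (Fin p) × ℝ => q.1 k / q.2)
      (volume.prod (volume.restrict (Set.Ioi (0:ℝ)))) volume := by
  have hm : Measurable fun q : EuclideanSpace ℝ (Fin p) × ℝ => q.1 k / q.2 := by fun_prop
  refine QuasiMeasurePreserving.prod_of_left hm ?_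
  refine (ae_restrict_iff' measurableSet_Ioi).mpr (Eventually.of_forall fun σ hσ => ?_)
  have h1 := (Measure.quasiMeasurePreserving_eval (fun _ : Fin p => (volume : Measure ℝ)) k).comp
    (PiLp.volume_preserving_ofLp (Fin p)).quasiMeasurePreserving
  have h2 := (Measure.quasiMeasurePreserving_smul (volume : Measure ℝ)
    (inv_ne_zero (ne_of_gt hσ))).comp h1
  simp only [div_eq_inv_mul]
  exact h2

lemma aestronglyMeasurable_scaledPrior (p : ℕ) {pβ : ℝ → ℝ} (h : Integrable pβ) :
    AEStronglyMeasurable (fun q : EuclideanSpace ℝ (Fin p) × ℝ => scaledPrior pβ q.1 q.2)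
      (volume.prod (volume.restrict (Set.Ioi (0:ℝ)))) := by
  refine Finset.aestronglyMeasurable_fun_prod _ fun k _ => ?_
  have hm : Measurable fun q : EuclideanSpace ℝ (Fin p) × ℝ => q.2⁻¹ := by fun_prop
  exact hm.aestronglyMeasurable.mul
    (h.aestronglyMeasurable.comp_quasiMeasurePreserving (quasiMeasurePreserving_coord_div p k))

lemma scaledPrior_nonneg {p : ℕ} {pβ : ℝ → ℝ} (h : ∀ t, 0 ≤ pβ t)
    (β : EuclideanSpace ℝ (Fin p)) {σ : ℝ} (hσ : 0 < σ) : 0 ≤ scaledPrior pβ β σ :=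
  Finset.prod_nonneg fun _ _ => mul_nonneg (inv_pos.mpr hσ).le (h _)

lemma integrable_mul_scaledPrior {p : ℕ} {pβ h : ℝ → ℝ} (h0 : ∀ t, 0 ≤ pβ t)
    (h1 : ∫ t, pβ t = 1) (hh : IntegrableOn h (Set.Ioi 0)) :
    Integrable (fun q : EuclideanSpace ℝ (Fin p) × ℝ => h q.2 * scaledPrior pβ q.1 q.2)
      (volume.prod (volume.restrict (Set.Ioi (0:ℝ)))) := by
  have hβ : Integrable pβ := .of_integral_ne_zero (by simp [h1])
  have hm := (hh.aestronglyMeasurable.comp_quasiMeasurePreserving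
    (Measure.quasiMeasurePreserving_snd (μ := (volume : Measure (EuclideanSpace ℝ (Fin p)))))).mul
    (aestronglyMeasurable_scaledPrior p hβ)
  refine (integrable_prod_iff' hm).mpr ⟨?_, ?_⟩
  · exact (ae_restrict_iff' measurableSet_Ioi).mpr (Eventually.of_forall fun σ hσ =>
      (integrable_scaledPrior hβ hσ).const_mul (h σ))
  · refine hh.norm.congr ?_
    refine (ae_restrict_iff' measurableSet_Ioi).mpr (Eventually.of_forall fun σ hσ => ?_)
    have : ∀ β : EuclideanSpace ℝ (Fin p),
        ‖h σ * scaledPrior pβ β σ‖ = ‖h σ‖ * scaledPrior pβ β σ := fun β => by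
      rw [norm_mul, Real.norm_of_nonneg (scaledPrior_nonneg h0 β hσ)]
    simp only [Pi.mul_apply, Function.comp_apply, this]
    rw [integral_const_mul, integral_scaledPrior h1 hσ, mul_one]

lemma integral_mul_scaledPrior {p : ℕ} {pβ h : ℝ → ℝ} (h0 : ∀ t, 0 ≤ pβ t)
    (h1 : ∫ t, pβ t = 1) (hh : IntegrableOn h (Set.Ioi 0)) :
    ∫ q : EuclideanSpace ℝ (Fin p) × ℝ, h q.2 * scaledPrior pβ q.1 q.2
      ∂(volume.prod (volume.restrict (Set.Ioi (0:ℝ)))) = ∫ σ in Set.Ioi 0, h σ := by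
  rw [integral_prod_symm _ (integrable_mul_scaledPrior h0 h1 hh)]
  refine setIntegral_congr_fun measurableSet_Ioi fun σ hσ => ?_
  simp only [integral_const_mul]
  rw [integral_scaledPrior h1 hσ, mul_one]

lemma tailRate_mul_scaled_fEH_le {γ s C : ℝ} (hγ : 0 < γ)
    (hC : ∀ z, fEH γ s z * tailRate γ z ≤ C) (hC0 : 0 < C) {δ ω σ r : ℝ} (hδ : 0 < δ) (hω : 0 < ω)
    (hσ : 0 < σ) (hr : δ * ω ≤ |r|) :
    tailRate γ ω * (σ⁻¹ * fEH γ s (r / σ)) ≤ C / δ * logFactor (σ / δ) ^ (1 + γ) := by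
  have hw : 0 < ω * (δ / σ) := by positivity
  have hle : |ω * (δ / σ)| ≤ |r / σ| := by
    rw [abs_of_pos hw, abs_div, abs_of_pos hσ, le_div_iff₀ hσ]
    refine le_trans (le_of_eq ?_) hr
    field_simp
  have h1 : fEH γ s (r / σ) ≤ C / tailRate γ (ω * (δ / σ)) := by
    have hpos := tailRate_pos γ hw.ne'
    have hmono := tailRate_mono hγ hle
    refine ((le_div_iff₀ (hpos.trans_le hmono)).mpr (hC _)).trans ?_
    gcongr
  have h2 : logFactor ω ^ (1 + γ) ≤
      logFactor (ω * (δ / σ)) ^ (1 + γ) * logFactor (σ / δ) ^ (1 + γ) := by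
    have h3 := logFactor_le_mul (z := ω) (div_pos hδ hσ).ne'
    rw [inv_div] at h3
    rw [← Real.mul_rpow (logFactor_pos _).le (logFactor_pos _).le]
    exact Real.rpow_le_rpow (logFactor_pos _).le h3 (by linarith)
  have hl : 0 < logFactor (ω * (δ / σ)) ^ (1 + γ) := Real.rpow_pos_of_pos (logFactor_pos _) _
  calc tailRate γ ω * (σ⁻¹ * fEH γ s (r / σ))
      ≤ tailRate γ ω * (σ⁻¹ * (C / tailRate γ (ω * (δ / σ)))) := by
        have := tailRate_nonneg γ ω
        gcongr
    _ = C / δ * (logFactor ω ^ (1 + γ) / logFactor (ω * (δ / σ)) ^ (1 + γ)) := by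
        rw [tailRate, tailRate, abs_of_pos hw, abs_of_pos hω]
        field_simp
    _ ≤ C / δ * logFactor (σ / δ) ^ (1 + γ) := by
        gcongr
        rw [div_le_iff₀ hl, mul_comm]
        exact h2

lemma inv_pow_mul_logFactor_pow_le {γ δ : ℝ} (hγ : 0 < γ) (hδ : 0 < δ) {N l : ℕ} (h : l ≤ N) :
    ∃ C : ℝ, ∀ σ : ℝ, 0 < σ →
      σ⁻¹ ^ N * (logFactor (σ / δ) ^ (1 + γ)) ^ l ≤ C * (1 + σ⁻¹ ^ N) := by
  rcases Nat.eq_zero_or_pos l with rfl | hl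
  · refine ⟨1, fun σ hσ => ?_⟩
    simp
  · obtain ⟨C, hC⟩ := logFactor_rpow_le ((1 + γ) * l) (by positivity)
    have hC0 : 0 ≤ C := by
      have h1 := hC 0 le_rfl
      have h2 : 0 < logFactor 0 ^ ((1 + γ) * l) := Real.rpow_pos_of_pos (logFactor_pos 0) _
      linarith
    refine ⟨C * (1 + δ⁻¹), fun σ hσ => ?_⟩
    have h1 := hC (σ / δ) (by positivity)
    rw [Real.rpow_mul (logFactor_pos _).le, Real.rpow_natCast] at h1
    have h2 : σ⁻¹ ^ N * σ ≤ 1 + σ⁻¹ ^ N := by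
      obtain ⟨k, rfl⟩ : ∃ k, N = k + 1 := ⟨N - 1, by omega⟩
      have e : σ⁻¹ ^ (k + 1) * σ = σ⁻¹ ^ k := by
        rw [pow_succ, mul_assoc, inv_mul_cancel₀ hσ.ne', mul_one]
      have hi : 0 < σ⁻¹ := inv_pos.mpr hσ
      rw [e]
      rcases le_total σ⁻¹ 1 with hle | hle
      · have := pow_le_one₀ hi.le hle (n := k)
        have : 0 < σ⁻¹ ^ (k + 1) := by positivity
        linarith
      · have := pow_le_pow_right₀ hle (Nat.le_succ k)
        simp only [Nat.succ_eq_add_one] at this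
        linarith
    have h3 : 0 < σ⁻¹ ^ N := by positivity
    calc σ⁻¹ ^ N * (logFactor (σ / δ) ^ (1 + γ)) ^ l
        ≤ σ⁻¹ ^ N * (C * (1 + σ / δ)) := by gcongr
      _ = C * (σ⁻¹ ^ N + σ⁻¹ ^ N * σ * δ⁻¹) := by ring
      _ ≤ C * ((1 + σ⁻¹ ^ N) + (1 + σ⁻¹ ^ N) * δ⁻¹) := by
          gcongr
          linarith
      _ = _ := by ring

lemma postNum_eq {n p : ℕ} (γ s : ℝ) (pβ pσ : ℝ → ℝ)
    (x : Fin n → EuclideanSpace ℝ (Fin p)) (S : Finset (Fin n)) (y : Fin n → ℝ)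
    (β : EuclideanSpace ℝ (Fin p)) (σ : ℝ) :
    postNum n p γ s pβ pσ x S y β σ =
      pσ σ * scaledPrior pβ β σ * ∏ i ∈ S, σ⁻¹ * fEH γ s ((y i - ⟪x i, β⟫) / σ) := rfl

lemma aestronglyMeasurable_postNum {n p : ℕ} (γ s : ℝ) {pβ pσ : ℝ → ℝ} (hβ : Integrable pβ)
    (hσ : IntegrableOn pσ (Set.Ioi 0)) (x : Fin n → EuclideanSpace ℝ (Fin p))
    (S : Finset (Fin n)) (y : Fin n → ℝ) :
    AEStronglyMeasurable
      (fun q : EuclideanSpace ℝ (Fin p) × ℝ => postNum n p γ s pβ pσ x S y q.1 q.2)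
      (volume.prod (volume.restrict (Set.Ioi (0:ℝ)))) := by
  have hf := measurable_fEH γ s
  have hm : Measurable fun q : EuclideanSpace ℝ (Fin p) × ℝ =>
      ∏ i ∈ S, q.2⁻¹ * fEH γ s ((y i - ⟪x i, q.1⟫) / q.2) := by fun_prop
  exact ((hσ.aestronglyMeasurable.comp_quasiMeasurePreserving
    Measure.quasiMeasurePreserving_snd).mul
    (aestronglyMeasurable_scaledPrior p hβ)).mul hm.aestronglyMeasurable

lemma integral_postNum_pos {n p : ℕ} {γ s : ℝ} (hγ : 0 < γ) (hs : s ∈ Set.Ioo (0:ℝ) 1)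
    {pβ pσ : ℝ → ℝ} (hpβ0 : ∀ t : ℝ, 0 ≤ pβ t) (hpβ1 : ∫ t : ℝ, pβ t = 1)
    (hpσ0 : ∀ u : ℝ, 0 ≤ pσ u) (hpσ1 : ∫ u in Set.Ioi (0:ℝ), pσ u = 1)
    (x : Fin n → EuclideanSpace ℝ (Fin p)) (S : Finset (Fin n)) (y : Fin n → ℝ)
    (hint : Integrable (fun q : EuclideanSpace ℝ (Fin p) × ℝ =>
      postNum n p γ s pβ pσ x S y q.1 q.2) (volume.prod (volume.restrict (Set.Ioi (0:ℝ))))) :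
    0 < ∫ q : EuclideanSpace ℝ (Fin p) × ℝ, postNum n p γ s pβ pσ x S y q.1 q.2
      ∂(volume.prod (volume.restrict (Set.Ioi (0:ℝ)))) := by
  have hσi : IntegrableOn pσ (Set.Ioi 0) := .of_integral_ne_zero (by simp [hpσ1])
  have hae : ∀ᵐ q : EuclideanSpace ℝ (Fin p) × ℝ
      ∂(volume.prod (volume.restrict (Set.Ioi (0:ℝ)))), 0 < q.2 :=
    Measure.quasiMeasurePreserving_snd.ae (ae_restrict_mem measurableSet_Ioi)
  have hlik : ∀ q : EuclideanSpace ℝ (Fin p) × ℝ, 0 < q.2 →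
      0 < ∏ i ∈ S, q.2⁻¹ * fEH γ s ((y i - ⟪x i, q.1⟫) / q.2) := fun q hq =>
    Finset.prod_pos fun i _ => mul_pos (inv_pos.mpr hq) (fEH_pos hγ hs _)
  have hnn : 0 ≤ᵐ[volume.prod (volume.restrict (Set.Ioi (0:ℝ)))]
      fun q : EuclideanSpace ℝ (Fin p) × ℝ => postNum n p γ s pβ pσ x S y q.1 q.2 := by
    filter_upwards [hae] with q hq
    rw [postNum_eq]
    exact mul_nonneg (mul_nonneg (hpσ0 _) (scaledPrior_nonneg hpβ0 _ hq)) (hlik q hq).le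
  refine lt_of_le_of_ne (integral_nonneg_of_ae hnn) fun h0 => ?_
  have h1 := (integral_eq_zero_iff_of_nonneg_ae hnn hint).mp h0.symm
  have h2 := integral_mul_scaledPrior (p := p) hpβ0 hpβ1 hσi
  rw [hpσ1, integral_eq_zero_of_ae] at h2
  · exact zero_ne_one h2
  · filter_upwards [hae, h1] with q hq hq0
    rw [postNum_eq] at hq0
    exact (mul_eq_zero.mp hq0).resolve_right (hlik q hq).ne'

/-- The likelihood of the full data, normalized by the order of its outlying factors, is dominated
uniformly in the coefficients and in large `ω` by a weight depending on `σ` only. -/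
lemma eventually_likelihood_le {n p : ℕ} {γ s : ℝ} (hγ : 0 < γ) (hs : s ∈ Set.Ioo (0:ℝ) 1)
    (x : Fin n → EuclideanSpace ℝ (Fin p))
    (hx : ∀ t : Finset (Fin n), t.card = p → LinearIndependent ℝ (fun i : t => x i))
    (K L : Finset (Fin n)) (hKL : Disjoint K L) (hKLuniv : K ∪ L = Finset.univ)
    (a b : Fin n → ℝ) (hb : ∀ i ∈ L, b i ≠ 0) (hA1 : L.card + p ≤ K.card) :
    ∃ C : ℝ, ∀ᶠ ω : ℝ in atTop, ∀ (β : EuclideanSpace ℝ (Fin p)) (σ : ℝ), 0 < σ →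
      tailRate γ ω ^ L.card * ∏ i, σ⁻¹ * fEH γ s
        (((if i ∈ K then a i else a i + b i * ω) - ⟪x i, β⟫) / σ) ≤
          C * (1 + σ⁻¹ ^ K.card) := by
  obtain ⟨δ, hδ, hres⟩ := eventually_exists_large_residuals x hx K L hKL a b hb hA1
  obtain ⟨M, hM⟩ := fEH_bounded hγ hs
  obtain ⟨B, hB0, hB⟩ := fEH_mul_tailRate_bounded hγ hs
  obtain ⟨D, hD⟩ := inv_pow_mul_logFactor_pow_le hγ hδ (show L.card ≤ K.card by omega)
  have hM0 : 0 < M := (fEH_pos hγ hs 0).trans_le (hM 0)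
  refine ⟨M ^ K.card * (B / δ) ^ L.card * D, ?_⟩
  filter_upwards [hres, eventually_gt_atTop 0] with ω hω hω0 β σ hσ
  obtain ⟨S, hS, hSr⟩ := hω β
  have hi : 0 < σ⁻¹ := inv_pos.mpr hσ
  have hcompl : Sᶜ.card = K.card := by
    have h1 := Finset.card_union_of_disjoint hKL
    rw [hKLuniv] at h1
    rw [Finset.card_compl, hS, ← Finset.card_univ, h1]
    omega
  rw [← Finset.prod_mul_prod_compl S, ← hS, ← mul_assoc, ← Finset.prod_const,
    ← Finset.prod_mul_distrib, hS]
  have hfac : ∀ i, 0 ≤ σ⁻¹ * fEH γ s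
      (((if i ∈ K then a i else a i + b i * ω) - ⟪x i, β⟫) / σ) := fun i =>
    mul_nonneg hi.le (fEH_pos hγ hs _).le
  have h1 := Finset.prod_le_prod (s := S)
    (fun i _ => mul_nonneg (tailRate_nonneg γ ω) (hfac i))
    (fun i hi => tailRate_mul_scaled_fEH_le hγ hB hB0 hδ hω0 hσ (hSr i hi))
  have h2 := Finset.prod_le_prod (s := Sᶜ) (fun i _ => hfac i)
    (fun i _ => mul_le_mul_of_nonneg_left (hM _) hi.le)
  rw [Finset.prod_const, hS] at h1
  rw [Finset.prod_const, hcompl] at h2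
  have hΛ : 0 < logFactor (σ / δ) ^ (1 + γ) := Real.rpow_pos_of_pos (logFactor_pos _) _
  calc _ ≤ (B / δ * logFactor (σ / δ) ^ (1 + γ)) ^ L.card * (σ⁻¹ * M) ^ K.card :=
        mul_le_mul h1 h2 (Finset.prod_nonneg fun i _ => hfac i) (by positivity)
    _ = M ^ K.card * (B / δ) ^ L.card *
          (σ⁻¹ ^ K.card * (logFactor (σ / δ) ^ (1 + γ)) ^ L.card) := by
        rw [mul_pow, mul_pow]
        ring
    _ ≤ M ^ K.card * (B / δ) ^ L.card * (D * (1 + σ⁻¹ ^ K.card)) := by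
        exact mul_le_mul_of_nonneg_left (hD σ hσ) (by positivity)
    _ = _ := by ring

/-- **Posterior robustness (Theorem 2.1).** Under assumptions (A.1)–(A.3), for the
linear regression model with the EH error distribution, the posterior density of
`(β,σ)` given the full data `D` (with outliers `y_i = a_i + b_i ω`, `i ∈ L`)
converges, as `ω → ∞`, to the posterior density given only the non-outlying data
`D* = {a_i : i ∈ K}`, at every `(β,σ) ∈ ℝ^p × (0,∞)`. -/
theorem posterior_robustness_EH (n p : ℕ) (γ s : ℝ) (hγ : 0 < γ)
    (hs : s ∈ Set.Ioo (0:ℝ) 1)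
    (x : Fin n → EuclideanSpace ℝ (Fin p))
    (hx : ∀ t : Finset (Fin n), t.card = p → LinearIndependent ℝ (fun i : t => x i))
    (pβ pσ : ℝ → ℝ)
    (hpβ0 : ∀ t : ℝ, 0 ≤ pβ t) (hpβ1 : ∫ t : ℝ, pβ t = 1)
    (hpσ0 : ∀ u : ℝ, 0 ≤ pσ u) (hpσ1 : ∫ u in Set.Ioi (0:ℝ), pσ u = 1)
    (K L : Finset (Fin n)) (hKL : Disjoint K L) (hKLuniv : K ∪ L = Finset.univ)
    (a b : Fin n → ℝ) (hb : ∀ i ∈ L, b i ≠ 0)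
    (c : ℝ) (hc : 0 < c)
    -- (A.1): #non-outliers ≥ #outliers + #predictors
    (hA1 : L.card + p ≤ K.card)
    -- (A.2): sup_t |t|^c π_β(t) < ∞
    (hA2 : BddAbove (Set.range fun t : ℝ => |t| ^ c * pβ t))
    -- (A.3): prior moments of σ^{-|K|}, σ^{c-1}, σ^{c-n} are finite
    (hA31 : IntegrableOn (fun u : ℝ => u ^ (-(K.card : ℝ)) * pσ u) (Set.Ioi 0))
    (hA32 : IntegrableOn (fun u : ℝ => u ^ (c - 1) * pσ u) (Set.Ioi 0))
    (hA33 : IntegrableOn (fun u : ℝ => u ^ (c - (n : ℝ)) * pσ u) (Set.Ioi 0)) :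
    ∀ β : EuclideanSpace ℝ (Fin p), ∀ σ : ℝ, 0 < σ →
      Filter.Tendsto
        (fun ω : ℝ =>
          postNum n p γ s pβ pσ x Finset.univ
              (fun i => if i ∈ K then a i else a i + b i * ω) β σ /
            ∫ q in (Set.univ ×ˢ Set.Ioi (0:ℝ) : Set (EuclideanSpace ℝ (Fin p) × ℝ)),
              postNum n p γ s pβ pσ x Finset.univ
                (fun i => if i ∈ K then a i else a i + b i * ω) q.1 q.2)
        Filter.atTop
        (nhds (postNum n p γ s pβ pσ x K a β σ /
          ∫ q in (Set.univ ×ˢ Set.Ioi (0:ℝ) : Set (EuclideanSpace ℝ (Fin p) × ℝ)),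
            postNum n p γ s pβ pσ x K a q.1 q.2)) := by
  intro β₀ σ₀ hσ₀
  set μ : Measure (EuclideanSpace ℝ (Fin p) × ℝ) :=
    volume.prod (volume.restrict (Set.Ioi (0:ℝ)))
  have hrestrict : (volume : Measure (EuclideanSpace ℝ (Fin p) × ℝ)).restrict
      (Set.univ ×ˢ Set.Ioi (0:ℝ)) = μ := by
    rw [Measure.volume_eq_prod, ← Measure.prod_restrict, Measure.restrict_univ]
  rw [hrestrict]
  have hβi : Integrable pβ := .of_integral_ne_zero (by simp [hpβ1])
  have hσi : IntegrableOn pσ (Set.Ioi 0) := .of_integral_ne_zero (by simp [hpσ1])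
  have hae : ∀ᵐ q : EuclideanSpace ℝ (Fin p) × ℝ ∂μ, 0 < q.2 :=
    Measure.quasiMeasurePreserving_snd.ae (ae_restrict_mem measurableSet_Ioi)
  obtain ⟨B, hB0, hBlim⟩ := tendsto_fEH_mul_tailRate hγ hs
  set P : ℝ := ∏ i ∈ L, B / |b i|
  have hP0 : 0 < P := Finset.prod_pos fun i hi => div_pos hB0 (abs_pos.mpr (hb i hi))
  have hpoint : ∀ (β : EuclideanSpace ℝ (Fin p)) (σ : ℝ), 0 < σ →
      Tendsto (fun ω : ℝ => tailRate γ ω ^ L.card *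
        postNum n p γ s pβ pσ x Finset.univ (fun i => if i ∈ K then a i else a i + b i * ω) β σ)
        atTop (nhds (postNum n p γ s pβ pσ x K a β σ * P)) := by
    intro β σ hσ
    have h1 : Tendsto (fun ω : ℝ => ∏ i ∈ L,
        tailRate γ ω * (σ⁻¹ * fEH γ s ((a i - ⟪x i, β⟫ + b i * ω) / σ))) atTop (nhds P) :=
      tendsto_finsetProd _ fun i hi =>
        tendsto_scaled_fEH_mul_tailRate hBlim (hb i hi) hσ _
    refine (h1.const_mul (postNum n p γ s pβ pσ x K a β σ)).congr fun ω => ?_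
    rw [postNum_eq, postNum_eq, ← hKLuniv, Finset.prod_union hKL,
      Finset.prod_mul_distrib (f := fun _ => tailRate γ ω), Finset.prod_const]
    have hK : ∏ i ∈ K, σ⁻¹ * fEH γ s
        (((if i ∈ K then a i else a i + b i * ω) - ⟪x i, β⟫) / σ) =
        ∏ i ∈ K, σ⁻¹ * fEH γ s ((a i - ⟪x i, β⟫) / σ) :=
      Finset.prod_congr rfl fun i hi => by rw [if_pos hi]
    have hL : ∏ i ∈ L, σ⁻¹ * fEH γ s
        (((if i ∈ K then a i else a i + b i * ω) - ⟪x i, β⟫) / σ) =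
        ∏ i ∈ L, σ⁻¹ * fEH γ s ((a i - ⟪x i, β⟫ + b i * ω) / σ) :=
      Finset.prod_congr rfl fun i hi => by
        rw [if_neg (Finset.disjoint_right.mp hKL hi), add_sub_right_comm]
    rw [hK, hL]
    ring
  obtain ⟨C, hC⟩ := eventually_likelihood_le hγ hs x hx K L hKL hKLuniv a b hb hA1
  have hweight : IntegrableOn (fun σ : ℝ => pσ σ * (C * (1 + σ⁻¹ ^ K.card))) (Set.Ioi 0) := by
    refine ((hσi.add hA31).const_mul C).congr ?_
    refine (ae_restrict_iff' measurableSet_Ioi).mpr (Eventually.of_forall fun σ hσ => ?_)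
    simp only [Pi.add_apply]
    rw [Real.rpow_neg (le_of_lt hσ), Real.rpow_natCast, inv_pow]
    ring
  have hdom := integrable_mul_scaledPrior (p := p) hpβ0 hpβ1 hweight
  have hbound : ∀ᶠ ω : ℝ in atTop, ∀ q : EuclideanSpace ℝ (Fin p) × ℝ, 0 < q.2 →
      ‖tailRate γ ω ^ L.card * postNum n p γ s pβ pσ x Finset.univ
        (fun i => if i ∈ K then a i else a i + b i * ω) q.1 q.2‖ ≤
      pσ q.2 * (C * (1 + q.2⁻¹ ^ K.card)) * scaledPrior pβ q.1 q.2 := by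
    filter_upwards [hC] with ω hω q hq
    have h1 := hω q.1 q.2 hq
    have h2 := mul_nonneg (hpσ0 q.2) (scaledPrior_nonneg hpβ0 q.1 hq)
    have h3 : 0 ≤ ∏ i, q.2⁻¹ * fEH γ s
        (((if i ∈ K then a i else a i + b i * ω) - ⟪x i, q.1⟫) / q.2) :=
      Finset.prod_nonneg fun i _ => mul_nonneg (inv_pos.mpr hq).le (fEH_pos hγ hs _).le
    rw [postNum_eq, Real.norm_of_nonneg
      (mul_nonneg (pow_nonneg (tailRate_nonneg γ ω) _) (mul_nonneg h2 h3))]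
    refine le_trans (le_of_eq ?_) ((mul_le_mul_of_nonneg_left h1 h2).trans (le_of_eq ?_)) <;> ring
  have hmeas : ∀ (S : Finset (Fin n)) (y : Fin n → ℝ), AEStronglyMeasurable
      (fun q : EuclideanSpace ℝ (Fin p) × ℝ => postNum n p γ s pβ pσ x S y q.1 q.2) μ :=
    aestronglyMeasurable_postNum γ s hβi hσi x
  have hlim : ∀ᵐ q : EuclideanSpace ℝ (Fin p) × ℝ ∂μ, Tendsto (fun ω : ℝ =>
      tailRate γ ω ^ L.card * postNum n p γ s pβ pσ x Finset.univ
        (fun i => if i ∈ K then a i else a i + b i * ω) q.1 q.2) atTop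
      (nhds (postNum n p γ s pβ pσ x K a q.1 q.2 * P)) :=
    hae.mono fun q hq => hpoint q.1 q.2 hq
  have hdenom := tendsto_integral_filter_of_dominated_convergence _
    (Eventually.of_forall fun ω => (hmeas Finset.univ _).const_mul _)
    (hbound.mono fun ω hω => hae.mono hω) hdom hlim
  have hKint : Integrable (fun q : EuclideanSpace ℝ (Fin p) × ℝ =>
      postNum n p γ s pβ pσ x K a q.1 q.2) μ := by
    have h1 : Integrable (fun q : EuclideanSpace ℝ (Fin p) × ℝ =>
        postNum n p γ s pβ pσ x K a q.1 q.2 * P) μ := by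
      refine hdom.mono' ((hmeas K a).mul_const P) ?_
      filter_upwards [hae] with q hq
      exact le_of_tendsto (hpoint q.1 q.2 hq).norm (hbound.mono fun ω hω => hω q hq)
    exact (integrable_mul_const_iff (isUnit_iff_ne_zero.mpr hP0.ne') _).mp h1
  have hKpos := integral_postNum_pos hγ hs hpβ0 hpβ1 hpσ0 hpσ1 x K a hKint
  rw [integral_mul_const] at hdenom
  have hquot := (hpoint β₀ σ₀ hσ₀).div hdenom (mul_pos hKpos hP0).ne'
  rw [mul_div_mul_right _ _ hP0.ne'] at hquot
  refine hquot.congr' ?_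
  filter_upwards [eventually_gt_atTop 0] with ω hω
  simp only [Pi.div_apply]
  rw [integral_const_mul, mul_div_mul_left _ _ (pow_pos (tailRate_pos γ hω.ne') _).ne']
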